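/- Let g ≥ 3 and K ≥ 1 be integers, and let j, k be natural numbers with k ≥ 2, gcd(k, g) = 1 and j not divisible by k. Then w_K(j/k) > K/⌈log_g k⌉ − 1. -/

import Mathlib

set_option autoImplicit false

noncomputable section

/-- Left endpoint of the fundamental interval for the centred base-`g` expansion:
`-1/2` for odd `g` and `-(g-2)/(2(g-1))` for even `g`. -/
def Lg (g : ℕ) : ℝ :=
  if g % 2 = 1 then -(1 / 2) else -(((g : ℝ) - 2) / (2 * ((g : ℝ) - 1)))

/-- The `i`-th digit (`i ≥ 1`) of the centred base-`g` expansion of (the representative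
modulo 1 of) `α`, chosen so that ambiguous expansions end in the minimal digit. -/
def centredDigit (g : ℕ) (α : ℝ) (i : ℕ) : ℤ :=
  ⌊(g : ℝ) ^ i * α - Lg g⌋ - g * ⌊(g : ℝ) ^ (i - 1) * α - Lg g⌋

/-- `w_K(α)`: the number of nonzero digits among the first `K` digits of the centred
base-`g` expansion of `α`. -/
def wK (g K : ℕ) (α : ℝ) : ℕ :=
  ((Finset.Icc 1 K).filter fun i => centredDigit g α i ≠ 0).card

theorem Lg_neg {g : ℕ} (hg : 3 ≤ g) : Lg g < 0 := by
  have h : (3 : ℝ) ≤ g := by exact_mod_cast hg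
  unfold Lg
  split_ifs
  · norm_num
  · exact neg_neg_of_pos (div_pos (by linarith) (by linarith))

theorem neg_one_lt_Lg {g : ℕ} (hg : 3 ≤ g) : -1 < Lg g := by
  have h : (3 : ℝ) ≤ g := by exact_mod_cast hg
  unfold Lg
  split_ifs
  · norm_num
  · rw [neg_lt_neg_iff, div_lt_one (by linarith)]
    linarith

/-- The remainder of `α` after subtracting its nearest integer in the sense of the centred
expansion has absolute value less than one. -/
theorem abs_sub_floor_sub_Lg_lt_one {g : ℕ} (hg : 3 ≤ g) (α : ℝ) :
    |α - ⌊α - Lg g⌋| < 1 := by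
  have h₁ := Int.floor_le (α - Lg g)
  have h₂ := Int.lt_floor_add_one (α - Lg g)
  rw [abs_lt]
  constructor <;> linarith [Lg_neg hg, neg_one_lt_Lg hg]

/-- Over a run of zero digits the integer parts are multiplied by powers of the base. -/
theorem floor_eq_pow_mul_of_centredDigit_eq_zero {g : ℕ} {α : ℝ} {i r : ℕ}
    (h : ∀ l ∈ Finset.Ioc i (i + r), centredDigit g α l = 0) :
    ⌊(g : ℝ) ^ (i + r) * α - Lg g⌋ = (g : ℤ) ^ r * ⌊(g : ℝ) ^ i * α - Lg g⌋ := by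
  induction r with
  | zero => simp
  | succ r ih =>
    have hlast := h (i + (r + 1)) (by simp)
    unfold centredDigit at hlast
    rw [← Nat.add_assoc, Nat.add_sub_cancel,
      ih fun l hl => h l (by simp only [Finset.mem_Ioc] at hl ⊢; omega)] at hlast
    rw [← Nat.add_assoc]
    linear_combination hlast

/-- A fraction whose denominator is at most `g ^ r` and coprime to `g` has a nonzero centred digit
among any `r` consecutive ones, unless it is an integer. -/
theorem exists_centredDigit_ne_zero {g j k r : ℕ} (hg : 3 ≤ g) (hk : 0 < k)
    (hgcd : Nat.gcd k g = 1) (hjk : ¬ k ∣ j) (hr : k ≤ g ^ r) (i : ℕ) :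
    ∃ l ∈ Finset.Ioc i (i + r), centredDigit g ((j : ℝ) / k) l ≠ 0 := by
  by_contra! h
  have hk' : (0 : ℝ) < k := by exact_mod_cast hk
  have hlt := abs_sub_floor_sub_Lg_lt_one hg ((g : ℝ) ^ (i + r) * ((j : ℝ) / k))
  rw [floor_eq_pow_mul_of_centredDigit_eq_zero h] at hlt
  set n := ⌊(g : ℝ) ^ i * ((j : ℝ) / k) - Lg g⌋
  have hne : (g : ℤ) ^ i * j - k * n ≠ 0 := by
    intro h₀
    have hdvd : (k : ℤ) ∣ ((g ^ i * j : ℕ) : ℤ) := ⟨n, by push_cast; linarith⟩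
    exact hjk ((Nat.Coprime.pow_right i hgcd).dvd_of_dvd_mul_left (Int.natCast_dvd_natCast.mp hdvd))
  have hone : (1 : ℝ) ≤ |(g : ℝ) ^ i * j - k * n| := by exact_mod_cast Int.one_le_abs hne
  have hpow : (k : ℝ) ≤ (g : ℝ) ^ r := by exact_mod_cast hr
  have heq : (g : ℝ) ^ (i + r) * ((j : ℝ) / k) - (((g : ℤ) ^ r * n : ℤ) : ℝ)
      = (g : ℝ) ^ r / k * ((g : ℝ) ^ i * j - k * n) := by
    push_cast
    field_simp
    ring
  rw [heq, abs_mul, abs_of_nonneg (by positivity)] at hlt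
  exact absurd hlt (not_lt.mpr (one_le_mul_of_one_le_of_one_le ((one_le_div hk').mpr hpow) hone))

/-- If every `r` consecutive positive integers contain one satisfying `p`, then at least `m` of the
first `m * r` do. -/
theorem le_card_filter_Icc_of_forall_exists {p : ℕ → Prop} [DecidablePred p] {r : ℕ}
    (h : ∀ i, ∃ l ∈ Finset.Ioc i (i + r), p l) (m : ℕ) :
    m ≤ ((Finset.Icc 1 (m * r)).filter p).card := by
  induction m with
  | zero => simp
  | succ m ih =>
    obtain ⟨l, hl, hpl⟩ := h (m * r)
    rw [Finset.mem_Ioc] at hl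
    have hnot : l ∉ (Finset.Icc 1 (m * r)).filter p := by
      simp only [Finset.mem_filter, Finset.mem_Icc]
      omega
    have hsub : insert l ((Finset.Icc 1 (m * r)).filter p) ⊆
        (Finset.Icc 1 ((m + 1) * r)).filter p := by
      intro x hx
      rw [add_one_mul]
      simp only [Finset.mem_insert, Finset.mem_filter, Finset.mem_Icc] at hx ⊢
      rcases hx with rfl | hx
      · exact ⟨by omega, hpl⟩
      · exact ⟨by omega, hx.2⟩
    have hcard := Finset.card_le_card hsub
    rw [Finset.card_insert_of_notMem hnot] at hcard
    omega

theorem statement18 (g K : ℕ) (hg : 3 ≤ g) (hK : 1 ≤ K) (j k : ℕ) (hk : 2 ≤ k)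
    (hgcd : Nat.gcd k g = 1) (hjk : ¬ k ∣ j) :
    (K : ℝ) / (⌈Real.logb g k⌉ : ℝ) - 1 < (wK g K ((j : ℝ) / (k : ℝ)) : ℝ) := by
  have hg' : (1 : ℝ) < g := by exact_mod_cast (by omega : 1 < g)
  have hk' : (1 : ℝ) < k := by exact_mod_cast (by omega : 1 < k)
  have hpos : 0 < ⌈Real.logb g k⌉ := Int.ceil_pos.mpr (Real.logb_pos hg' hk')
  obtain ⟨r, hr⟩ := Int.eq_ofNat_of_zero_le hpos.le
  have hr_pos : 0 < r := by omega
  have hle : Real.logb g k ≤ (r : ℝ) := by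
    have := Int.le_ceil (Real.logb g k)
    rw [hr] at this
    exact_mod_cast this
  rw [Real.logb_le_iff_le_rpow hg' (by linarith), Real.rpow_natCast] at hle
  have hblock := exists_centredDigit_ne_zero hg (by omega) hgcd hjk (r := r) (by exact_mod_cast hle)
  have hw : K / r ≤ wK g K ((j : ℝ) / k) :=
    (le_card_filter_Icc_of_forall_exists hblock (K / r)).trans <| Finset.card_le_card <|
      Finset.filter_subset_filter _ (Finset.Icc_subset_Icc_right (Nat.div_mul_le_self K r))
  have hlt : K < (wK g K ((j : ℝ) / k) + 1) * r := by
    rw [← Nat.div_lt_iff_lt_mul hr_pos]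
    omega
  rw [hr, sub_lt_iff_lt_add, Int.cast_natCast,
    div_lt_iff₀ (by exact_mod_cast hr_pos)]
  exact_mod_cast hlt
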